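/- Let a < b be real numbers and s ≥ 1 an integer, and let D^s = {v ∈ ℝ^s : ‖v‖ ≤ 1} denote the closed Euclidean unit ball of ℝ^s. Let H : [a,b] × D^s → ℝ × ℝ^s be a continuous map, written H(t,v) = (h₁(t,v), h₂(t,v)) ∈ ℝ × ℝ^s. Assume: (i) ‖h₂(t,v)‖ < 1 for every (t,v) ∈ [a,b] × D^s; (ii) h₁(a,v) > a for every v ∈ D^s; (iii) h₁(b,v) < b for every v ∈ D^s. Then H has a fixed point in [a,b] × D^s, i.e., there exists (t₀,v₀) ∈ [a,b] × D^s with h₁(t₀,v₀) = t₀ and h₂(t₀,v₀) = v₀. -/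

import Mathlib

open Set

/-- The value of `det (1 + A)` is an affine combination, with weights independent of `A`, of the
values `det (1 + τ • A)` at finitely many arbitrarily small `τ`. -/
lemma exists_weights_det_one_add {E : Type*} [NormedAddCommGroup E] [NormedSpace ℝ E]
    [FiniteDimensional ℝ E] {δ : ℝ} (hδ : 0 < δ) :
    ∃ (n : ℕ) (w τ : ℕ → ℝ), (∀ i, 0 < τ i ∧ τ i < δ) ∧ ∑ i ∈ Finset.range n, w i = 1 ∧
      ∀ A : E →L[ℝ] E, (1 + A).det = ∑ i ∈ Finset.range n, w i * (1 + τ i • A).det := by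
  classical
  let b := Module.finBasis ℝ E
  set n := Module.finrank ℝ E + 1 with hn
  let τ : ℕ → ℝ := fun i => δ / (i + 2)
  have hinj : Set.InjOn τ (Finset.range n) := by
    intro i _ j _ hij
    have h1 : ((i : ℝ) + 2) ≠ 0 := by positivity
    have h2 : ((j : ℝ) + 2) ≠ 0 := by positivity
    simp only [τ] at hij
    rw [div_eq_div_iff h1 h2] at hij
    have := mul_left_cancel₀ hδ.ne' hij
    exact_mod_cast (by linarith : (i : ℝ) = j)
  refine ⟨n, fun i => (Lagrange.basis (Finset.range n) τ i).eval 1, τ, fun i => ⟨by positivity, ?_⟩,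
    ?_, fun A => ?_⟩
  · exact div_lt_self hδ (by have : (0 : ℝ) ≤ i := by positivity
                             linarith)
  · rw [← Polynomial.eval_finsetSum, Lagrange.sum_basis hinj ⟨0, by simp [hn]⟩, Polynomial.eval_one]
  · let M := LinearMap.toMatrix b b A.toLinearMap
    let p : Polynomial ℝ := Matrix.det ((Polynomial.X : Polynomial ℝ) • M.map Polynomial.C +
      (1 : Matrix _ _ ℝ).map Polynomial.C)
    have hp : ∀ t : ℝ, (1 + t • A).det = p.eval t := by
      intro t
      have h1 : (1 + t • A).det = (1 + t • M).det := by
        rw [ContinuousLinearMap.det, ← LinearMap.det_toMatrix b]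
        congr 1
        simp [M, LinearMap.toMatrix_one, ContinuousLinearMap.toLinearMap_add]
      rw [h1]
      simp only [p]
      rw [← Polynomial.coe_evalRingHom, RingHom.map_det]
      congr 1
      ext i j
      by_cases hij : i = j
      · simp [hij]
        ring
      · simp [hij]
        ring
    have hdeg : p.degree < (Finset.range n).card := by
      refine lt_of_le_of_lt Polynomial.degree_le_natDegree ?_
      have := Polynomial.natDegree_det_X_add_C_le M 1
      simp only [Fintype.card_fin] at this
      rw [Finset.card_range]
      exact_mod_cast Nat.lt_succ_of_le this
    have h1 := hp 1
    rw [one_smul] at h1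
    rw [h1]
    conv_lhs => rw [Lagrange.eq_interpolate hinj hdeg]
    rw [Lagrange.interpolate_apply, Polynomial.eval_finsetSum]
    refine Finset.sum_congr rfl fun i _ => ?_
    rw [Polynomial.eval_mul, Polynomial.eval_C, hp, mul_comm]

/-- A map that is Lipschitz on the closed unit ball, vanishes on the sphere and outside the ball,
is globally Lipschitz. -/
lemma lipschitzWith_of_eq_zero_off_ball {E : Type*} [NormedAddCommGroup E] [NormedSpace ℝ E]
    {g : E → E} {K : NNReal} (hg : LipschitzOnWith K g (Metric.closedBall 0 1))
    (h0 : ∀ x, 1 ≤ ‖x‖ → g x = 0) : LipschitzWith K g := by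
  have key : ∀ x y : E, ‖x‖ ≤ 1 → 1 ≤ ‖y‖ → dist (g x) (g y) ≤ K * dist x y := by
    intro x y hx hy
    have hc : ContinuousOn (fun t : ℝ => ‖AffineMap.lineMap x y t‖) (Set.Icc 0 1) := by
      simp only [AffineMap.lineMap_apply_module]
      fun_prop
    obtain ⟨t, ht, hz⟩ := intermediate_value_Icc (zero_le_one' ℝ) hc
      (show (1 : ℝ) ∈ _ by simpa using ⟨hx, hy⟩)
    simp only at hz
    rw [h0 y hy, ← h0 _ hz.ge]
    refine (hg.dist_le_mul x (by simpa using hx) _ (by simpa using hz.le)).trans ?_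
    rw [dist_left_lineMap, Real.norm_of_nonneg ht.1]
    gcongr
    exact mul_le_of_le_one_left dist_nonneg ht.2
  refine LipschitzWith.of_dist_le_mul fun x y => ?_
  rcases le_total ‖x‖ 1 with hx | hx <;> rcases le_total ‖y‖ 1 with hy | hy
  · exact hg.dist_le_mul x (by simpa using hx) y (by simpa using hy)
  · exact key x y hx hy
  · rw [dist_comm, dist_comm x]; exact key y x hy hx
  · rw [h0 x hx, h0 y hy, dist_self]; positivity

open MeasureTheory in
/-- Small Lipschitz perturbations of the identity supported in the unit ball preserve its
volume. -/
lemma setIntegral_det_one_add_smul_fderiv {E : Type*} [NormedAddCommGroup E] [NormedSpace ℝ E]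
    [FiniteDimensional ℝ E] [MeasurableSpace E] [BorelSpace E] (μ : Measure E)
    [μ.IsAddHaarMeasure] {g : E → E} {K : NNReal} (hg : LipschitzWith K g)
    (h0 : ∀ x, 1 ≤ ‖x‖ → g x = 0) (hd : ∀ x, ‖x‖ < 1 → DifferentiableAt ℝ g x) :
    ∃ δ : ℝ, 0 < δ ∧ ∀ t, 0 < t → t < δ →
      ∫ x in Metric.ball (0 : E) 1, (1 + t • fderiv ℝ g x).det ∂μ = μ.real (Metric.ball 0 1) := by
  have hdet : ∀ᶠ A : E →L[ℝ] E in nhds 1, 0 < A.det := by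
    refine ContinuousLinearMap.continuous_det.continuousAt.eventually_const_lt ?_
    simp [ContinuousLinearMap.det]
  obtain ⟨ε, hε, hdet⟩ := Metric.eventually_nhds_iff.1 hdet
  refine ⟨min ε 1 / (K + 1), by positivity, fun t ht htδ => ?_⟩
  rw [lt_div_iff₀ (by positivity)] at htδ
  have hK : (0 : ℝ) ≤ K := K.2
  have htε : t * K < ε := by have := min_le_left ε 1; nlinarith
  have ht1 : t * K < 1 := by have := min_le_right ε 1; nlinarith
  let f : E → E := fun x => x + t • g x
  have happ : ApproximatesLinearOn f (ContinuousLinearEquiv.refl ℝ E : E →L[ℝ] E) univ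
      (t.toNNReal * K) := by
    intro x _ y _
    have : f x - f y - (ContinuousLinearEquiv.refl ℝ E : E →L[ℝ] E) (x - y) = t • (g x - g y) := by
      simp only [f, ContinuousLinearEquiv.coe_refl, ContinuousLinearMap.id_apply, smul_sub]
      abel
    rw [this, norm_smul, Real.norm_of_nonneg ht.le, NNReal.coe_mul, Real.coe_toNNReal t ht.le,
      mul_assoc]
    gcongr
    exact hg.norm_sub_le x y
  have hc : Subsingleton E ∨ t.toNNReal * K <
      ‖((ContinuousLinearEquiv.refl ℝ E).symm : E →L[ℝ] E)‖₊⁻¹ := by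
    rcases subsingleton_or_nontrivial E with h | h
    · exact Or.inl h
    · right
      rw [← NNReal.coe_lt_coe]
      simpa [ht.le] using ht1
  have hinj : Function.Injective f := injOn_univ.1 (happ.injOn hc)
  have hsurj : Function.Surjective f := happ.surjective hc
  have hout : ∀ x, 1 ≤ ‖x‖ → f x = x := fun x hx => by simp [f, h0 x hx]
  have himg : f '' Metric.ball 0 1 = Metric.ball 0 1 := by
    have h : f '' (Metric.ball 0 1)ᶜ = (Metric.ball 0 1)ᶜ := by
      conv_rhs => rw [← image_id (Metric.ball (0 : E) 1)ᶜ]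
      exact image_congr fun x hx => hout x (by simpa using hx)
    rw [image_compl_eq ⟨hinj, hsurj⟩] at h
    exact compl_injective h
  have hf' : ∀ x ∈ Metric.ball (0 : E) 1,
      HasFDerivWithinAt f (1 + t • fderiv ℝ g x) (Metric.ball 0 1) x := fun x hx =>
    ((hasFDerivAt_id x).add ((hd x (by simpa using hx)).hasFDerivAt.const_smul t)).hasFDerivWithinAt
  have hcov := integral_image_eq_integral_abs_det_fderiv_smul μ Metric.isOpen_ball.measurableSet
    hf' hinj.injOn (fun _ => (1 : ℝ))
  rw [himg] at hcov
  simp only [smul_eq_mul, mul_one, integral_const, measureReal_restrict_apply_univ] at hcov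
  rw [hcov]
  refine setIntegral_congr_fun Metric.isOpen_ball.measurableSet fun x _ => ?_
  refine (abs_of_pos (hdet ?_)).symm
  rw [dist_eq_norm, add_sub_cancel_left, norm_smul, Real.norm_of_nonneg ht.le]
  refine lt_of_le_of_lt ?_ htε
  gcongr
  exact norm_fderiv_le_of_lipschitz ℝ hg

open MeasureTheory in
/-- There is no `C¹` retraction of the closed unit ball onto its boundary sphere. -/
lemma not_exists_contDiffAt_retraction {E : Type*} [NormedAddCommGroup E] [InnerProductSpace ℝ E]
    [FiniteDimensional ℝ E] {r : E → E} (hr : ∀ x, ‖x‖ ≤ 1 → ContDiffAt ℝ 1 r x)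
    (hnorm : ∀ x, ‖x‖ ≤ 1 → ‖r x‖ = 1) (hid : ∀ x, ‖x‖ = 1 → r x = x) : False := by
  classical
  let _ : MeasurableSpace E := borel E
  have : BorelSpace E := ⟨rfl⟩
  let μ : Measure E := Measure.addHaar
  let g : E → E := fun x => if ‖x‖ ≤ 1 then r x - x else 0
  have hgB : Set.EqOn g (fun x => r x - x) (Metric.closedBall 0 1) := fun x hx =>
    if_pos (by simpa using hx)
  have h0 : ∀ x, 1 ≤ ‖x‖ → g x = 0 := by
    intro x hx
    by_cases h : ‖x‖ ≤ 1
    · simp [g, h, hid x (le_antisymm h hx)]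
    · simp [g, h]
  have hdr : ∀ x, ‖x‖ ≤ 1 → DifferentiableAt ℝ (fun x => r x - x) x := fun x hx =>
    ((hr x hx).differentiableAt one_ne_zero).sub differentiableAt_id
  have hcont : ContinuousOn (fderiv ℝ fun x => r x - x) (Metric.closedBall 0 1) := fun x hx =>
    (((hr x (by simpa using hx)).sub contDiffAt_id).fderiv_right
      (m := 0) (by simp)).continuousAt.continuousWithinAt
  obtain ⟨C, hC⟩ := (isCompact_closedBall (0 : E) 1).exists_bound_of_continuousOn hcont
  have hlip : LipschitzOnWith C.toNNReal g (Metric.closedBall 0 1) := by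
    have : LipschitzOnWith C.toNNReal (fun x => r x - x) (Metric.closedBall 0 1) :=
      (convex_closedBall (0 : E) 1).lipschitzOnWith_of_nnnorm_fderiv_le
        (fun x hx => hdr x (by simpa using hx))
        (fun x hx => by
          rw [← NNReal.coe_le_coe, coe_nnnorm]
          exact (hC x hx).trans (Real.le_coe_toNNReal C))
    intro x hx y hy
    rw [hgB hx, hgB hy]
    exact this hx hy
  have hglip := lipschitzWith_of_eq_zero_off_ball hlip h0
  have hev : ∀ x ∈ Metric.ball (0 : E) 1, g =ᶠ[nhds x] fun x => r x - x := fun x hx =>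
    Filter.eventuallyEq_of_mem (Metric.isOpen_ball.mem_nhds hx)
      fun y hy => hgB (Metric.ball_subset_closedBall hy)
  have hgd : ∀ x, ‖x‖ < 1 → DifferentiableAt ℝ g x := fun x hx =>
    (hdr x hx.le).congr_of_eventuallyEq (hev x (by simpa using hx))
  have hgfd : ∀ x ∈ Metric.ball (0 : E) 1, fderiv ℝ g x = fderiv ℝ (fun x => r x - x) x :=
    fun x hx => (hev x hx).fderiv_eq
  obtain ⟨δ, hδ, hint⟩ := setIntegral_det_one_add_smul_fderiv μ hglip h0 hgd
  obtain ⟨n, w, τ, hτ, hw, hsum⟩ := exists_weights_det_one_add (E := E) hδ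
  have hintegrable : ∀ t : ℝ, IntegrableOn (fun x => (1 + t • fderiv ℝ g x).det)
      (Metric.ball (0 : E) 1) μ := by
    intro t
    have h : ContinuousOn (fun x => (1 + t • fderiv ℝ (fun x => r x - x) x).det)
        (Metric.closedBall (0 : E) 1) :=
      ContinuousLinearMap.continuous_det.comp_continuousOn
        (continuousOn_const.add (hcont.const_smul t))
    refine ((h.integrableOn_compact (μ := μ) (isCompact_closedBall (0 : E) 1)).mono_set
      Metric.ball_subset_closedBall).congr_fun (fun x hx => ?_) Metric.isOpen_ball.measurableSet
    simp only [hgfd x hx]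
  have htotal : ∫ x in Metric.ball (0 : E) 1, (1 + fderiv ℝ g x).det ∂μ =
      μ.real (Metric.ball 0 1) := by
    rw [integral_congr_ae (ae_of_all _ fun x => hsum (fderiv ℝ g x)),
      integral_finsetSum _ fun i _ => (hintegrable (τ i)).const_mul (w i)]
    simp only [integral_const_mul, hint _ (hτ _).1 (hτ _).2]
    rw [← Finset.sum_mul, hw, one_mul]
  have hzero : ∀ x ∈ Metric.ball (0 : E) 1, (1 + fderiv ℝ g x).det = 0 := by
    intro x hx
    have hx1 : ‖x‖ ≤ 1 := by simpa using (Metric.ball_subset_closedBall hx)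
    have hrd := (hr x hx1).differentiableAt one_ne_zero
    have hfd : 1 + fderiv ℝ g x = fderiv ℝ r x := by
      rw [hgfd x hx, fderiv_fun_sub hrd differentiableAt_fun_id, fderiv_fun_id]
      exact add_sub_cancel _ _
    rw [hfd]
    by_contra hne
    have hunit : IsUnit (fderiv ℝ r x : E →ₗ[ℝ] E) :=
      LinearMap.isUnit_iff_isUnit_det _ |>.2 (isUnit_iff_ne_zero.2 hne)
    obtain ⟨v, hv⟩ := ((Module.End.isUnit_iff _).1 hunit).2 (r x)
    have hconst : (fun y => inner ℝ (r y) (r y)) =ᶠ[nhds x] fun _ => (1 : ℝ) :=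
      Filter.eventuallyEq_of_mem (Metric.isOpen_ball.mem_nhds hx) fun y hy => by
        simp [hnorm y (by simpa using (Metric.ball_subset_closedBall hy))]
    have h := hconst.fderiv_eq (𝕜 := ℝ)
    have h2 := congrArg (fun L : E →L[ℝ] ℝ => L v) h
    have hv' : fderiv ℝ r x v = r x := hv
    rw [fderiv_inner_apply ℝ hrd hrd, hv', real_inner_self_eq_norm_sq, hnorm x hx1] at h2
    norm_num at h2
  rw [setIntegral_congr_fun Metric.isOpen_ball.measurableSet hzero] at htotal
  simp only [integral_zero] at htotal
  exact (ENNReal.toReal_pos (Metric.measure_ball_pos μ (0 : E) one_pos).ne'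
    measure_ball_lt_top.ne).ne htotal

/-- A `C¹` map into the open unit ball has a fixed point. -/
lemma exists_fixedPoint_of_contDiff {E : Type*} [NormedAddCommGroup E] [InnerProductSpace ℝ E]
    [FiniteDimensional ℝ E] {g : E → E} (hg : ContDiff ℝ 1 g) (hb : ∀ x, ‖g x‖ < 1) :
    ∃ x, g x = x := by
  by_contra! hne
  let u : E → E := fun x => x - g x
  have hu : ∀ x, u x ≠ 0 := fun x => sub_ne_zero.2 (hne x).symm
  have hucd : ContDiff ℝ 1 u := contDiff_id.sub hg
  let D : E → ℝ := fun x => inner ℝ x (u x) ^ 2 + ‖u x‖ ^ 2 * (1 - ‖x‖ ^ 2)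
  have hDcd : ContDiff ℝ 1 D := by
    have := contDiff_id.inner ℝ hucd
    have h2 := hucd.norm_sq ℝ
    have h3 : ContDiff ℝ 1 fun x : E => ‖x‖ ^ 2 := contDiff_id.norm_sq ℝ
    exact (this.pow 2).add (h2.mul (contDiff_const.sub h3))
  have hsphere : ∀ x, ‖x‖ = 1 → 0 < inner ℝ x (u x) := by
    intro x hx
    have h1 := real_inner_le_norm x (g x)
    have h2 := hb x
    simp only [u, inner_sub_right, real_inner_self_eq_norm_sq, hx] at h1 ⊢
    linarith
  have hD : ∀ x, ‖x‖ ≤ 1 → 0 < D x := by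
    intro x hx
    rcases hx.lt_or_eq with h | h
    · have h1 : 0 < ‖u x‖ ^ 2 := by have := norm_pos_iff.2 (hu x); positivity
      have h2 : 0 < 1 - ‖x‖ ^ 2 := by nlinarith [norm_nonneg x]
      have := mul_pos h1 h2
      have := sq_nonneg (inner ℝ x (u x) : ℝ)
      simp only [D]; linarith
    · simp only [D, h]
      have := hsphere x h
      norm_num
      positivity
  let l : E → ℝ := fun x => (-inner ℝ x (u x) + √(D x)) / ‖u x‖ ^ 2
  have hu2 : ∀ x, ‖u x‖ ^ 2 ≠ 0 := fun x => by simpa using hu x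
  refine not_exists_contDiffAt_retraction (r := fun x => x + l x • u x) (fun x hx => ?_)
    (fun x hx => ?_) (fun x hx => ?_)
  · have h1 : ContDiffAt ℝ 1 (fun x => √(D x)) x := hDcd.contDiffAt.sqrt (hD x hx).ne'
    have h2 : ContDiffAt ℝ 1 (fun x => (inner ℝ x (u x) : ℝ)) x :=
      (contDiff_id.inner ℝ hucd).contDiffAt
    have h3 : ContDiffAt ℝ 1 l x :=
      (h2.neg.add h1).div (hucd.norm_sq ℝ).contDiffAt (hu2 x)
    exact contDiffAt_id.add (h3.smul hucd.contDiffAt)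
  · have hsq : √(D x) ^ 2 = D x := Real.sq_sqrt (hD x hx).le
    have hl : l x * ‖u x‖ ^ 2 = -inner ℝ x (u x) + √(D x) := div_mul_cancel₀ _ (hu2 x)
    have : ‖x + l x • u x‖ ^ 2 = 1 := by
      rw [norm_add_sq_real, inner_smul_right, norm_smul, mul_pow, Real.norm_eq_abs, sq_abs]
      refine mul_left_cancel₀ (hu2 x) ?_
      simp only [D] at hsq
      set s := √(inner ℝ x (u x) ^ 2 + ‖u x‖ ^ 2 * (1 - ‖x‖ ^ 2))
      have hl' : l x * ‖u x‖ ^ 2 = -inner ℝ x (u x) + s := hl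
      linear_combination (l x * ‖u x‖ ^ 2 + inner ℝ x (u x) + s) * hl' + hsq
    exact (pow_eq_one_iff_of_nonneg (norm_nonneg _) two_ne_zero).1 this
  · have : l x = 0 := by
      simp only [l, D, hx]
      norm_num
      rw [Real.sqrt_sq (hsphere x hx).le]
      simp
    simp [this]

open Manifold in
/-- **Brouwer's fixed point theorem** for maps into the open unit ball. -/
lemma exists_fixedPoint_of_norm_lt_one {E : Type*} [NormedAddCommGroup E] [InnerProductSpace ℝ E]
    [FiniteDimensional ℝ E] {f : E → E} (hf : Continuous f) (hb : ∀ x, ‖f x‖ < 1) :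
    ∃ x, f x = x := by
  by_contra! hne
  obtain ⟨g, hg⟩ := exists_contMDiffMap_forall_mem_convex_of_local_const (n := 1)
    (t := fun x => Metric.ball (f x) (dist (f x) x) ∩ Metric.ball (0 : E) 1) 𝓘(ℝ, E)
    (fun x => (convex_ball _ _).inter (convex_ball _ _))
    (fun x => ⟨f x, by
      have h1 : ∀ᶠ y in nhds x, dist (f x) (f y) < dist (f y) y := by
        refine Filter.Tendsto.eventually_lt (y := 0) (z := dist (f x) x) ?_ ?_
          (dist_pos.2 (hne x))
        · simpa using (tendsto_const_nhds (x := f x)).dist (hf.tendsto x)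
        · exact (hf.dist continuous_id).tendsto x
      filter_upwards [h1] with y hy
      exact ⟨hy, by simpa using hb x⟩⟩)
  obtain ⟨x, hx⟩ := exists_fixedPoint_of_contDiff (g := g) g.contMDiff.contDiff
    fun x => by simpa using (hg x).2
  have := (hg x).1
  rw [hx, Metric.mem_ball, dist_comm] at this
  exact this.false

/-- **Brouwer's fixed point theorem** for bounded continuous self-maps. -/
lemma exists_fixedPoint_of_norm_lt {E : Type*} [NormedAddCommGroup E] [InnerProductSpace ℝ E]
    [FiniteDimensional ℝ E] {f : E → E} (hf : Continuous f) {R : ℝ} (hb : ∀ x, ‖f x‖ < R) :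
    ∃ x, f x = x := by
  have hR : 0 < R := (norm_nonneg _).trans_lt (hb 0)
  obtain ⟨x, hx⟩ := exists_fixedPoint_of_norm_lt_one (f := fun x => R⁻¹ • f (R • x))
    (by fun_prop) fun x => by
      rw [norm_smul, norm_inv, Real.norm_of_nonneg hR.le, inv_mul_lt_one₀ hR]
      exact hb _
  exact ⟨R • x, by
    conv_rhs => rw [← hx]
    rw [smul_inv_smul₀ hR.ne']⟩

/-- Fixed point lemma: a continuous map `H = (h₁, h₂)` of the solid cylinder
`[a,b] × D^s` into `ℝ × ℝ^s` with `‖h₂‖ < 1` everywhere, `h₁(a, ·) > a` and `h₁(b, ·) < b`,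
has a fixed point in `[a,b] × D^s`. -/
theorem fixed_point_of_cylinder_map
    {s : ℕ} (hs : 1 ≤ s) (a b : ℝ) (hab : a < b)
    (H : ℝ × EuclideanSpace ℝ (Fin s) → ℝ × EuclideanSpace ℝ (Fin s))
    (hcont : ContinuousOn H
      (Set.Icc a b ×ˢ Metric.closedBall (0 : EuclideanSpace ℝ (Fin s)) 1))
    (hball : ∀ p ∈ Set.Icc a b ×ˢ Metric.closedBall (0 : EuclideanSpace ℝ (Fin s)) 1,
      ‖(H p).2‖ < 1)
    (hA : ∀ w ∈ Metric.closedBall (0 : EuclideanSpace ℝ (Fin s)) 1, a < (H (a, w)).1)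
    (hB : ∀ w ∈ Metric.closedBall (0 : EuclideanSpace ℝ (Fin s)) 1, (H (b, w)).1 < b) :
    ∃ p ∈ Set.Icc a b ×ˢ Metric.closedBall (0 : EuclideanSpace ℝ (Fin s)) 1,
      H p = p := by
  let E := EuclideanSpace ℝ (Fin s)
  let ρ : ℝ × E → ℝ × E := fun p => (max a (min b p.1), (max 1 ‖p.2‖)⁻¹ • p.2)
  have hpos : ∀ v : E, 0 < max 1 ‖v‖ := fun v => lt_max_of_lt_left one_pos
  have hρc : Continuous ρ := by
    have : Continuous fun p : ℝ × E => (max 1 ‖p.2‖)⁻¹ :=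
      Continuous.inv₀ (by fun_prop) fun p => (hpos p.2).ne'
    fun_prop
  have hρmem : ∀ p, ρ p ∈ Set.Icc a b ×ˢ Metric.closedBall (0 : E) 1 := by
    intro p
    refine ⟨⟨le_max_left _ _, max_le hab.le (min_le_left _ _)⟩, ?_⟩
    rw [mem_closedBall_zero_iff, norm_smul, norm_inv, Real.norm_of_nonneg (hpos _).le,
      inv_mul_le_one₀ (hpos _)]
    exact le_max_right _ _
  have hHc : Continuous fun p => H (ρ p) := hcont.comp_continuous hρc hρmem
  let F : ℝ × E → ℝ × E := fun p => (max a (min b (H (ρ p)).1), (H (ρ p)).2)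
  have hFc : Continuous F :=
    (continuous_const.max (continuous_const.min hHc.fst)).prodMk hHc.snd
  obtain ⟨x, hx⟩ := exists_fixedPoint_of_norm_lt (E := WithLp 2 (ℝ × E))
    (f := fun x => WithLp.toLp 2 (F (WithLp.ofLp x)))
    ((WithLp.prod_continuous_toLp 2 ℝ E).comp (hFc.comp (WithLp.prod_continuous_ofLp 2 ℝ E)))
    (R := max |a| |b| + 1) (fun x => by
      set p := WithLp.ofLp x
      have h1 : |(F p).1| ≤ max |a| |b| :=
        abs_le_max_abs_abs (le_max_left _ _) (max_le hab.le (min_le_left _ _))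
      have h2 : ‖(F p).2‖ < 1 := hball _ (hρmem p)
      have h3 := WithLp.prod_norm_sq_eq_of_L2 (WithLp.toLp 2 (F p))
      simp only [WithLp.toLp_fst, WithLp.toLp_snd, Real.norm_eq_abs] at h3
      have h4 := abs_nonneg (F p).1
      have h5 := norm_nonneg (F p).2
      refine lt_of_le_of_lt (b := |(F p).1| + ‖(F p).2‖) ?_ (by linarith)
      exact abs_le_of_sq_le_sq' (by nlinarith) (by positivity) |>.2)
  set p := WithLp.ofLp x
  have hp : F p = p := congrArg WithLp.ofLp hx
  have hp1 : max a (min b (H (ρ p)).1) = p.1 := congrArg (fun q : ℝ × E => q.1) hp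
  have hp2 : (H (ρ p)).2 = p.2 := (congrArg (fun q : ℝ × E => q.2) hp :)
  have ha1 : a ≤ p.1 := hp1 ▸ le_max_left _ _
  have hb1 : p.1 ≤ b := hp1 ▸ max_le hab.le (min_le_left _ _)
  have hv : ‖p.2‖ ≤ 1 := hp2 ▸ (hball _ (hρmem p)).le
  have hρp : ρ p = p := by
    refine Prod.ext ?_ ?_
    · simp [ρ, ha1, hb1]
    · simp [ρ, hv]
  rw [hρp] at hp1 hp2
  have hpe : p = (p.1, p.2) := rfl
  have hne_a : p.1 ≠ a := by
    intro h
    have := hA p.2 (by simpa using hv)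
    rw [← h, ← hpe] at this
    have h2 := le_max_right a (min b (H p).1)
    rw [hp1] at h2
    exact absurd (lt_min (h ▸ hab) this) h2.not_gt
  have hne_b : p.1 ≠ b := by
    intro h
    have := hB p.2 (by simpa using hv)
    rw [← h, ← hpe] at this
    have h2 : max a (min b (H p).1) < p.1 :=
      max_lt (h ▸ hab) ((min_le_right _ _).trans_lt this)
    exact h2.ne hp1
  refine ⟨p, ⟨⟨ha1, hb1⟩, by simpa using hv⟩, Prod.ext ?_ hp2⟩
  rcases max_choice a (min b (H p).1) with h | h <;> rw [h] at hp1
  · exact absurd hp1.symm hne_a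
  · rcases min_choice b (H p).1 with h' | h' <;> rw [h'] at hp1
    · exact absurd hp1.symm hne_b
    · exact hp1
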